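/- arXiv:1112.1124 — 2 statements merged into one kernel-verified Lean document; each statement's English description precedes it below -/
import Mathlib

section
/- Let o, s₁, s₂, s₃ be points in the plane such that o, s₁, s₂, s₃ are in convex position (i.e., conv{o,s₁,s₂,s₃} is a quadrilateral with these four points as vertices, in counterclockwise order o, s₁, s₂, s₃). Then s₂ lies in the interior of conv{o, r₁, r₂, r₃} whenever each rᵢ lies on the ray from o through sᵢ strictly beyond sᵢ. -/
/-- Counterclockwise orientation of a triple of points in the plane. -/
def Ccw (p q r : ℝ × ℝ) : Prop :=
  0 < (q.1 - p.1) * (r.2 - p.2) - (q.2 - p.2) * (r.1 - p.1)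

/-- If `o, s₁, s₂, s₃` are in convex position in counterclockwise order and
each `rᵢ` lies on the ray from `o` through `sᵢ` strictly beyond `sᵢ`, then
`s₂` lies in the interior of the quadrilateral `conv {o, r₁, r₂, r₃}`. -/
theorem middle_point_in_interior (o s₁ s₂ s₃ r₁ r₂ r₃ : ℝ × ℝ)
    (h₁ : Ccw o s₁ s₂) (h₂ : Ccw s₁ s₂ s₃) (h₃ : Ccw s₂ s₃ o) (h₄ : Ccw s₃ o s₁)
    (t₁ t₂ t₃ : ℝ) (ht₁ : 1 < t₁) (ht₂ : 1 < t₂) (ht₃ : 1 < t₃)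
    (hr₁ : r₁ = o + t₁ • (s₁ - o)) (hr₂ : r₂ = o + t₂ • (s₂ - o))
    (hr₃ : r₃ = o + t₃ • (s₃ - o)) :
    s₂ ∈ interior (convexHull ℝ {o, r₁, r₂, r₃}) := by
  have _ := h₂
  obtain ⟨o1, o2⟩ := o
  obtain ⟨a1, a2⟩ := s₁
  obtain ⟨b1, b2⟩ := s₂
  obtain ⟨c1, c2⟩ := s₃
  simp only [Ccw] at h₁ h₃ h₄
  obtain ⟨D, hD⟩ : ∃ D, D = (a1 - o1) * (c2 - o2) - (a2 - o2) * (c1 - o1) := ⟨_, rfl⟩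
  have hDpos : 0 < D := by rw [hD]; linarith
  obtain ⟨A, hA⟩ : ∃ A : ℝ × ℝ → ℝ,
    A = fun p => ((p.1 - o1) * (c2 - o2) - (p.2 - o2) * (c1 - o1)) / D := ⟨_, rfl⟩
  obtain ⟨B, hB⟩ : ∃ B : ℝ × ℝ → ℝ,
    B = fun p => ((a1 - o1) * (p.2 - o2) - (a2 - o2) * (p.1 - o1)) / D := ⟨_, rfl⟩
  have hAc : Continuous A := by rw [hA]; fun_prop
  have hBc : Continuous B := by rw [hB]; fun_prop
  have hx : ∀ p : ℝ × ℝ, p.1 - o1 = A p * (a1 - o1) + B p * (c1 - o1) := by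
    intro p
    have := hDpos.ne'
    simp only [hA, hB]
    field_simp
    rw [hD]; ring
  have hy : ∀ p : ℝ × ℝ, p.2 - o2 = A p * (a2 - o2) + B p * (c2 - o2) := by
    intro p
    have := hDpos.ne'
    simp only [hA, hB]
    field_simp
    rw [hD]; ring
  have ha : 0 < A (b1, b2) := by
    simp only [hA]
    exact div_pos (by linarith) hDpos
  have hb : 0 < B (b1, b2) := by
    simp only [hB]
    exact div_pos (by linarith) hDpos
  have hbx := hx (b1, b2)
  have hby := hy (b1, b2)
  simp only at hbx hby
  obtain ⟨a, haa⟩ : ∃ a, a = A (b1, b2) := ⟨_, rfl⟩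
  obtain ⟨b, hbb⟩ : ∃ b, b = B (b1, b2) := ⟨_, rfl⟩
  rw [← haa] at ha hbx hby
  rw [← hbb] at hb hbx hby
  have p1 : 0 < t₁ := by linarith
  have p2 : 0 < t₂ := by linarith
  have p3 : 0 < t₃ := by linarith
  obtain ⟨K, hK⟩ : ∃ K, K = a / t₁ + b / t₃ := ⟨_, rfl⟩
  have hKpos : 0 < K := by rw [hK]; positivity
  obtain ⟨u, hu⟩ : ∃ u, u = 1 / t₂ := ⟨_, rfl⟩
  have hu0 : 0 < u := by rw [hu]; positivity
  have hu1 : u < 1 := by rw [hu, div_lt_one p2]; exact ht₂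
  obtain ⟨e, he⟩ : ∃ e, e = (1 - u) / (1 + K) := ⟨_, rfl⟩
  have he0 : 0 < e := by rw [he]; exact div_pos (by linarith) (by linarith)
  have heq : e * (1 + K) = 1 - u := by rw [he]; field_simp
  have he1 : e < 1 := by nlinarith [mul_pos he0 hKpos]
  let w1 : ℝ × ℝ → ℝ := fun p => (A p - (1 - e) * a) / t₁
  let w3 : ℝ × ℝ → ℝ := fun p => (B p - (1 - e) * b) / t₃
  let w2 : ℝ := (1 - e) * u
  let w0 : ℝ × ℝ → ℝ := fun p => 1 - w1 p - w2 - w3 p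
  have c1' : Continuous w1 := by fun_prop
  have c3' : Continuous w3 := by fun_prop
  have c0' : Continuous w0 := by fun_prop
  rw [mem_interior]
  refine ⟨{p | 0 < w1 p} ∩ {p | 0 < w3 p} ∩ {p | 0 < w0 p}, ?_, ?_, ?_⟩
  · rintro p ⟨⟨q1, q3⟩, q0⟩
    simp only [Set.mem_ofPred_eq] at q1 q3 q0
    have q2 : 0 < w2 := mul_pos (by linarith) hu0
    have hp : p = w0 p • ((o1, o2) : ℝ × ℝ) + w1 p • r₁ + w2 • r₂ + w3 p • r₃ := by
      have e1 : w1 p * t₁ = A p - (1 - e) * a := by simp only [w1]; field_simp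
      have e3 : w3 p * t₃ = B p - (1 - e) * b := by simp only [w3]; field_simp
      have e2 : w2 * t₂ = 1 - e := by simp only [w2, hu]; field_simp
      have e0 : w0 p = 1 - w1 p - w2 - w3 p := rfl
      rw [hr₁, hr₂, hr₃, e0]
      ext
      · simp only [Prod.fst_add, Prod.smul_fst, Prod.fst_sub, smul_eq_mul]
        linear_combination hx p - (a1 - o1) * e1 - (c1 - o1) * e3 - (b1 - o1) * e2
          - (1 - e) * hbx
      · simp only [Prod.snd_add, Prod.smul_snd, Prod.snd_sub, smul_eq_mul]
        linear_combination hy p - (a2 - o2) * e1 - (c2 - o2) * e3 - (b2 - o2) * e2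
          - (1 - e) * hby
    have hc := convex_convexHull ℝ ({(o1, o2), r₁, r₂, r₃} : Set (ℝ × ℝ))
    have hs := hc.sum_mem (t := Finset.univ) (w := ![w0 p, w1 p, w2, w3 p])
      (z := ![(o1, o2), r₁, r₂, r₃])
      (by intro i _; fin_cases i <;> simp <;> linarith)
      (by simp [Fin.sum_univ_four, w0]; ring)
      (by intro i _; apply subset_convexHull; fin_cases i <;> simp)
    simp [Fin.sum_univ_four] at hs
    rw [hp]
    simpa using hs
  · exact ((isOpen_lt continuous_const c1').inter (isOpen_lt continuous_const c3')).inter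
      (isOpen_lt continuous_const c0')
  · have v1 : w1 (b1, b2) = e * (a / t₁) := by simp only [w1, ← haa]; ring
    have v3 : w3 (b1, b2) = e * (b / t₃) := by simp only [w3, ← hbb]; ring
    refine ⟨⟨?_, ?_⟩, ?_⟩
    · simp only [Set.mem_ofPred_eq, v1]; positivity
    · simp only [Set.mem_ofPred_eq, v3]; positivity
    · have v0 : w0 (b1, b2) = 1 - e * K - (1 - e) * u := by
        simp only [w0, v1, v3, w2, hK]; ring
      simp only [Set.mem_ofPred_eq, v0]
      nlinarith [mul_pos he0 hu0]
end

section
/- For every n ≥ 6, there exists a set S of n points in the plane such that every Steiner convex partition of S has at least ⌈(n-1)/2⌉ tiles; combined with the upper bound, g₂(n) = ⌈(n-1)/2⌉. -/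
/-- A Steiner convex partition of a finite planar point set `S`. -/
def IsSteinerConvexPartition (S : Finset (EuclideanSpace ℝ (Fin 2)))
    (𝒯 : Finset (Set (EuclideanSpace ℝ (Fin 2)))) : Prop :=
  (∀ t ∈ 𝒯, Convex ℝ t ∧ IsCompact t ∧ ∀ p ∈ S, p ∉ interior t) ∧
  (⋃ t ∈ 𝒯, t) = convexHull ℝ (S : Set (EuclideanSpace ℝ (Fin 2))) ∧
  ((𝒯 : Set (Set (EuclideanSpace ℝ (Fin 2)))).Pairwise
    fun t₁ t₂ => interior t₁ ∩ interior t₂ = ∅)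

namespace SCP

abbrev Pl := EuclideanSpace ℝ (Fin 2)

noncomputable def fnl (α β : ℝ) : Pl →L[ℝ] ℝ :=
  α • (EuclideanSpace.proj 0 : Pl →L[ℝ] ℝ) + β • (EuclideanSpace.proj 1 : Pl →L[ℝ] ℝ)

lemma fnl_apply (α β : ℝ) (x : Pl) : fnl α β x = α * x 0 + β * x 1 := by
  simp [fnl]

lemma fnl_ne {α β : ℝ} (h : α ≠ 0 ∨ β ≠ 0) : fnl α β ≠ 0 := by
  intro h0
  have h1 := congrArg (fun f : Pl →L[ℝ] ℝ => f !₂[1, 0]) h0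
  have h2 := congrArg (fun f : Pl →L[ℝ] ℝ => f !₂[0, 1]) h0
  simp [fnl_apply] at h1 h2
  tauto

lemma eq_fnl (g : Pl →L[ℝ] ℝ) : ∃ α β, g = fnl α β := by
  refine ⟨g !₂[1, 0], g !₂[0, 1], ?_⟩
  ext x
  have hx : x = (x 0) • (!₂[1, 0] : Pl) + (x 1) • (!₂[0, 1] : Pl) := by
    ext i; fin_cases i <;> simp
  rw [fnl_apply]
  conv_lhs => rw [hx]
  rw [map_add, map_smul, map_smul]; simp; ring

lemma pl_ext {x y : Pl} (h0 : x 0 = y 0) (h1 : x 1 = y 1) : x = y := by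
  ext i; fin_cases i <;> simpa

lemma interior_lt {g : Pl →L[ℝ] ℝ} (hg : g ≠ 0) {c : ℝ} {t : Set Pl}
    (ht : ∀ x ∈ t, g x ≤ c) {x : Pl} (hx : x ∈ interior t) : g x < c := by
  have hs : Function.Surjective g := by
    apply LinearMap.surjective (f := (g : Pl →ₗ[ℝ] ℝ))
    intro h; apply hg; ext y; exact congrArg (fun f : Pl →ₗ[ℝ] ℝ => f y) h
  have ho := g.isOpenMap hs
  have h1 : g '' interior t ⊆ interior (Set.Iic c) := by
    apply interior_maximal _ (ho _ isOpen_interior)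
    rintro _ ⟨y, hy, rfl⟩
    exact ht y (interior_subset hy)
  have := h1 ⟨x, hx, rfl⟩
  simpa using this

lemma interior_gt {g : Pl →L[ℝ] ℝ} (hg : g ≠ 0) {c : ℝ} {t : Set Pl}
    (ht : ∀ x ∈ t, c ≤ g x) {x : Pl} (hx : x ∈ interior t) : c < g x := by
  have := interior_lt (g := -g) (neg_ne_zero.2 hg) (c := -c) (t := t)
    (fun x hx => by simpa using ht x hx) hx
  simpa using this

/-- supporting line through two points of a finite set -/
lemma exists_line (P : Finset Pl) (hP : 2 ≤ P.card) :
    ∃ g : Pl →L[ℝ] ℝ, g ≠ 0 ∧ ∃ c, (∀ x ∈ P, c ≤ g x) ∧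
      ∃ p ∈ P, ∃ q ∈ P, p ≠ q ∧ g p = c ∧ g q = c := by
  classical
  have hne : P.Nonempty := Finset.card_pos.1 (by omega)
  obtain ⟨p, hp, hmin⟩ := P.exists_min_image (fun x => x 0) hne
  by_cases hq : ∃ q ∈ P, q ≠ p ∧ q 0 = p 0
  · obtain ⟨q, hq, hqp, hq0⟩ := hq
    refine ⟨fnl 1 0, fnl_ne (by simp), p 0, ?_, p, hp, q, hq, hqp.symm, ?_, ?_⟩
    · intro x hx; simpa [fnl_apply] using hmin x hx
    · simp [fnl_apply]
    · simp [fnl_apply, hq0]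
  · push Not at hq
    have hlt : ∀ q ∈ P.erase p, p 0 < q 0 := by
      intro q hq'
      rw [Finset.mem_erase] at hq'
      exact lt_of_le_of_ne (hmin q hq'.2) (fun h => hq q hq'.2 hq'.1 h.symm)
    have hne' : (P.erase p).Nonempty := Finset.card_pos.1 (by
      rw [Finset.card_erase_of_mem hp]; omega)
    obtain ⟨q, hqm, hqmin⟩ := (P.erase p).exists_min_image
      (fun x => (x 1 - p 1) / (x 0 - p 0)) hne'
    set s := (q 1 - p 1) / (q 0 - p 0) with hs
    have hq0 := hlt q hqm
    have hqm' := Finset.mem_erase.1 hqm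
    refine ⟨fnl (-s) 1, fnl_ne (by simp), -s * p 0 + p 1, ?_, p, hp, q, hqm'.2, hqm'.1.symm, ?_, ?_⟩
    · intro x hx
      by_cases hxp : x = p
      · subst hxp; simp [fnl_apply]
      · have hxm : x ∈ P.erase p := Finset.mem_erase.2 ⟨hxp, hx⟩
        have h1 : s ≤ (x 1 - p 1) / (x 0 - p 0) := hqmin x hxm
        rw [le_div_iff₀ (by linarith [hlt x hxm])] at h1
        rw [fnl_apply]; linarith
    · simp [fnl_apply]
    · have : s * (q 0 - p 0) = q 1 - p 1 := by
        rw [hs]; field_simp [(sub_pos.2 hq0).ne']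
      rw [fnl_apply]; linarith

lemma cut (k : ℕ) : ∀ P : Finset Pl, P.card = k → ∀ C : Set Pl, Convex ℝ C → IsCompact C →
    ∃ 𝒯 : Finset (Set Pl), (∀ t ∈ 𝒯, Convex ℝ t ∧ IsCompact t ∧ ∀ p ∈ P, p ∉ interior t) ∧
      (⋃ t ∈ 𝒯, t) = C ∧ ((𝒯 : Set (Set Pl)).Pairwise
        fun t₁ t₂ => interior t₁ ∩ interior t₂ = ∅) ∧ 2 * 𝒯.card ≤ k + 3 := by
  classical
  induction k using Nat.strong_induction_on with
  | _ k ih =>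
  intro P hk C hC hCc
  rcases Nat.eq_zero_or_pos k with rfl | hpos
  · refine ⟨{C}, ?_, by simp, by simp, by simp⟩
    rw [Finset.card_eq_zero] at hk
    subst hk
    simp [hC, hCc]
  obtain ⟨g, hg, c, hPc, hcard⟩ : ∃ g : Pl →L[ℝ] ℝ, g ≠ 0 ∧ ∃ c, (∀ x ∈ P, c ≤ g x) ∧
      ((P.filter (fun x => c < g x)).card + 2 ≤ k ∨
        (P.filter (fun x => c < g x)).card = 0 ∧ k = 1) := by
    rcases Nat.lt_or_ge k 2 with h | h
    · have h1 : k = 1 := by omega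
      obtain ⟨p, rfl⟩ := Finset.card_eq_one.1 (hk.trans h1)
      refine ⟨fnl 1 0, fnl_ne (by simp), fnl 1 0 p, by simp, Or.inr ⟨?_, h1⟩⟩
      rw [Finset.card_eq_zero, Finset.filter_eq_empty_iff]
      simp
    · obtain ⟨g, hg, c, h1, p, hp, q, hq, hpq, hp', hq'⟩ := exists_line P (by omega)
      refine ⟨g, hg, c, h1, Or.inl ?_⟩
      have hsub : P.filter (fun x => c < g x) ⊆ (P.erase p).erase q := by
        intro x hx
        rw [Finset.mem_filter] at hx
        rw [Finset.mem_erase, Finset.mem_erase]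
        refine ⟨?_, ?_, hx.1⟩
        · rintro rfl; linarith [hx.2]
        · rintro rfl; linarith [hx.2]
      have := Finset.card_le_card hsub
      rw [Finset.card_erase_of_mem (Finset.mem_erase.2 ⟨hpq.symm, hq⟩),
        Finset.card_erase_of_mem hp] at this
      omega
  have hup : Convex ℝ {x | c ≤ g x} := convex_halfSpace_ge g.toLinearMap.isLinear c
  have hlo : Convex ℝ {x | g x ≤ c} := convex_halfSpace_le g.toLinearMap.isLinear c
  have hupc : IsClosed {x | c ≤ g x} := isClosed_le continuous_const g.continuous
  have hloc : IsClosed {x | g x ≤ c} := isClosed_le g.continuous continuous_const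
  obtain ⟨𝒯, h1, h2, h3, h4⟩ := ih (P.filter (fun x => c < g x)).card (by omega) _ rfl
    (C ∩ {x | c ≤ g x}) (hC.inter hup) (hCc.inter_right hupc)
  have hT : ∀ t ∈ 𝒯, ∀ x ∈ t, c ≤ g x := by
    intro t ht x hx
    have : x ∈ ⋃ t ∈ 𝒯, t := Set.mem_biUnion ht hx
    rw [h2] at this
    exact this.2
  have hdis : ∀ t ∈ 𝒯, interior (C ∩ {x | g x ≤ c}) ∩ interior t = ∅ := by
    intro t ht
    rw [Set.eq_empty_iff_forall_notMem]
    rintro x ⟨hx1, hx2⟩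
    have a := interior_lt hg (c := c) (fun x (hx : x ∈ C ∩ {x | g x ≤ c}) => hx.2) hx1
    have b := interior_gt hg (hT t ht) hx2
    linarith
  refine ⟨insert (C ∩ {x | g x ≤ c}) 𝒯, ?_, ?_, ?_, ?_⟩
  · intro t ht
    rw [Finset.mem_insert] at ht
    rcases ht with rfl | ht
    · refine ⟨hC.inter hlo, hCc.inter_right hloc, ?_⟩
      intro p hp hpi
      have a := interior_lt hg (c := c) (fun x (hx : x ∈ C ∩ {x | g x ≤ c}) => hx.2) hpi
      linarith [hPc p hp]
    · refine ⟨(h1 t ht).1, (h1 t ht).2.1, ?_⟩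
      intro p hp hpi
      have b := interior_gt hg (hT t ht) hpi
      exact (h1 t ht).2.2 p (Finset.mem_filter.2 ⟨hp, b⟩) hpi
  · rw [Finset.set_biUnion_insert, h2]
    ext x
    simp only [Set.mem_union, Set.mem_inter_iff, Set.mem_ofPred_eq]
    have := le_total (g x) c
    tauto
  · rw [Finset.coe_insert, Set.pairwise_insert]
    refine ⟨h3, fun t ht _ => ⟨hdis t ht, ?_⟩⟩
    rw [Set.inter_comm]; exact hdis t ht
  · have := Finset.card_insert_le (C ∩ {x | g x ≤ c}) 𝒯
    omega

lemma three_out (S : Finset Pl) (hi : (interior (convexHull ℝ (S : Set Pl))).Nonempty)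
    (u v : Pl) (h : ∀ x ∈ S, x ∉ interior (convexHull ℝ (S : Set Pl)) → x = u ∨ x = v) :
    False := by
  obtain ⟨g, hg, hguv⟩ : ∃ g : Pl →L[ℝ] ℝ, g ≠ 0 ∧ g u = g v := by
    by_cases huv : u = v
    · exact ⟨fnl 1 0, fnl_ne (by simp), by rw [huv]⟩
    · refine ⟨fnl (u 1 - v 1) (v 0 - u 0), fnl_ne ?_, ?_⟩
      · by_contra hc
        push Not at hc
        exact huv (pl_ext (by linarith [hc.2]) (by linarith [hc.1]))
      · simp only [fnl_apply]; ring
  have hS : S.Nonempty := by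
    rw [Finset.nonempty_iff_ne_empty]; rintro rfl; simp at hi
  have hext : ∀ c, (∀ x ∈ S, g x ≤ c) → ∀ x ∈ convexHull ℝ (S : Set Pl), g x ≤ c := by
    intro c hc x hx
    exact convexHull_min (s := (S : Set Pl)) (t := {x | g x ≤ c}) hc
      (convex_halfSpace_le g.toLinearMap.isLinear c) hx
  have hext' : ∀ c, (∀ x ∈ S, c ≤ g x) → ∀ x ∈ convexHull ℝ (S : Set Pl), c ≤ g x := by
    intro c hc x hx
    exact convexHull_min (s := (S : Set Pl)) (t := {x | c ≤ g x}) hc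
      (convex_halfSpace_ge g.toLinearMap.isLinear c) hx
  obtain ⟨a, ha, hamax⟩ := S.exists_max_image g hS
  obtain ⟨b, hb, hbmin⟩ := S.exists_min_image g hS
  have ha' := h a ha (fun hh => lt_irrefl _ (interior_lt hg (hext _ hamax) hh))
  have hb' := h b hb (fun hh => lt_irrefl _ (interior_gt hg (hext' _ hbmin) hh))
  have hab : g a = g b := by
    rcases ha' with rfl | rfl <;> rcases hb' with rfl | rfl <;> simp [hguv]
  obtain ⟨x, hx⟩ := hi
  have := interior_lt hg (hext _ hamax) hx
  have := interior_gt hg (hext' _ hbmin) hx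
  linarith

lemma upper (n : ℕ) (hn : 6 ≤ n) (S : Finset Pl) (hS : S.card = n) :
    ∃ 𝒯 : Finset (Set Pl), IsSteinerConvexPartition S 𝒯 ∧ 𝒯.card ≤ ⌈((n : ℚ) - 1) / 2⌉₊ := by
  classical
  have hle : n ≤ 2 * ⌈((n : ℚ) - 1) / 2⌉₊ + 1 := by
    have := Nat.le_ceil (((n : ℚ) - 1) / 2)
    have h2 : (n : ℚ) ≤ 2 * (⌈((n : ℚ) - 1) / 2⌉₊ : ℚ) + 1 := by linarith
    exact_mod_cast h2
  have hCc : IsCompact (convexHull ℝ (S : Set Pl)) := Set.Finite.isCompact_convexHull (𝕜 := ℝ) S.finite_toSet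
  have hC := convex_convexHull ℝ (S : Set Pl)
  set C := convexHull ℝ (S : Set Pl) with hCdef
  obtain ⟨𝒯, h1, h2, h3, h4⟩ := cut _ (S.filter (fun x => x ∈ interior C)) rfl C hC hCc
  refine ⟨𝒯, ⟨?_, h2, h3⟩, ?_⟩
  · intro t ht
    refine ⟨(h1 t ht).1, (h1 t ht).2.1, fun p hp hpi => ?_⟩
    have htC : t ⊆ C := by
      rw [← h2]; exact fun x hx => Set.mem_biUnion ht hx
    exact (h1 t ht).2.2 p (Finset.mem_filter.2 ⟨hp, interior_mono htC hpi⟩) hpi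
  · have hsum := S.card_filter_add_card_filter_not (fun x => x ∈ interior C)
    rcases Set.eq_empty_or_nonempty (interior C) with he | hne
    · have : (S.filter (fun x => x ∈ interior C)).card = 0 := by simp [he]
      omega
    · have : 3 ≤ (S.filter (fun x => ¬ x ∈ interior C)).card := by
        by_contra hlt
        push Not at hlt
        obtain ⟨u, v, huv⟩ : ∃ u v : Pl, S.filter (fun x => ¬ x ∈ interior C) ⊆ {u, v} := by
          have : (S.filter (fun x => ¬ x ∈ interior C)).card = 0 ∨
            (S.filter (fun x => ¬ x ∈ interior C)).card = 1 ∨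
            (S.filter (fun x => ¬ x ∈ interior C)).card = 2 := by omega
          rcases this with h | h | h
          · exact ⟨0, 0, by rw [Finset.card_eq_zero.1 h]; simp⟩
          · obtain ⟨u, hu⟩ := Finset.card_eq_one.1 h
            exact ⟨u, u, by rw [hu]; simp⟩
          · obtain ⟨u, v, _, hu⟩ := Finset.card_eq_two.1 h
            exact ⟨u, v, by rw [hu]⟩
        refine three_out S hne u v (fun x hx hxi => ?_)
        simpa using huv (Finset.mem_filter.2 ⟨hx, hxi⟩)
      omega

noncomputable def bp (i : ℕ) : Pl := !₂[(i : ℝ), (i : ℝ) ^ 2]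

lemma separate {t t' : Set Pl} (ht : Convex ℝ t) (ht' : Convex ℝ t')
    (hi : (interior t).Nonempty) (hi' : (interior t').Nonempty)
    (hd : interior t ∩ interior t' = ∅) :
    ∃ α β c : ℝ, (α ≠ 0 ∨ β ≠ 0) ∧ (∀ x ∈ t, α * x 0 + β * x 1 ≤ c) ∧
      ∀ x ∈ t', c ≤ α * x 0 + β * x 1 := by
  obtain ⟨f, c, h1, h2⟩ := geometric_hahn_banach_open ht.interior isOpen_interior ht'.interior
    (Set.disjoint_iff_inter_eq_empty.2 hd)
  obtain ⟨α, β, rfl⟩ := eq_fnl f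
  refine ⟨α, β, c, ?_, ?_, ?_⟩
  · by_contra hc
    push Not at hc
    obtain ⟨x, hx⟩ := hi
    obtain ⟨y, hy⟩ := hi'
    have a := h1 x hx
    have b := h2 y hy
    simp only [fnl_apply, hc.1, hc.2] at a b
    linarith
  · intro x hx
    have hx' : x ∈ closure (interior t) := by
      rw [ht.closure_interior_eq_closure_of_nonempty_interior hi]; exact subset_closure hx
    have : closure (interior t) ⊆ {x | fnl α β x ≤ c} :=
      closure_minimal (fun y hy => (h1 y hy).le)
        (isClosed_le (fnl α β).continuous continuous_const)
    have h3 : fnl α β x ≤ c := this hx'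
    rwa [fnl_apply] at h3
  · intro x hx
    have hx' : x ∈ closure (interior t') := by
      rw [ht'.closure_interior_eq_closure_of_nonempty_interior hi']; exact subset_closure hx
    have : closure (interior t') ⊆ {x | c ≤ fnl α β x} :=
      closure_minimal (fun y hy => h2 y hy)
        (isClosed_le continuous_const (fnl α β).continuous)
    have h3 : c ≤ fnl α β x := this hx'
    rwa [fnl_apply] at h3

/-- A point of the parabola in two tiles is extreme (leftmost or rightmost) in one of them. -/
lemma not_both {t t' : Set Pl} (ht : Convex ℝ t) (ht' : Convex ℝ t')
    (hi : (interior t).Nonempty) (hi' : (interior t').Nonempty)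
    (hd : interior t ∩ interior t' = ∅) {a b c a' c' : ℕ}
    (hab : a < b) (hbc : b < c) (hab' : a' < b) (hbc' : b < c')
    (h1 : bp a ∈ t) (h2 : bp b ∈ t) (h3 : bp c ∈ t)
    (h1' : bp a' ∈ t') (h2' : bp b ∈ t') (h3' : bp c' ∈ t') : False := by
  obtain ⟨α, β, γ, hne, hle, hge⟩ := separate ht ht' hi hi' hd
  have e1 := hle _ h1
  have e2 := hle _ h2
  have e3 := hle _ h3
  have f1 := hge _ h1'
  have f2 := hge _ h2'
  have f3 := hge _ h3'
  simp only [bp, PiLp.toLp_apply, Matrix.cons_val_zero, Matrix.cons_val_one,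
    Matrix.cons_val_fin_one] at e1 e2 e3 f1 f2 f3
  have hab : (a : ℝ) < b := by exact_mod_cast hab
  have hbc : (b : ℝ) < c := by exact_mod_cast hbc
  have hab' : (a' : ℝ) < b := by exact_mod_cast hab'
  have hbc' : (b : ℝ) < c' := by exact_mod_cast hbc'
  generalize (a : ℝ) = a at *
  generalize (b : ℝ) = b at *
  generalize (c : ℝ) = c at *
  generalize (a' : ℝ) = a' at *
  generalize (c' : ℝ) = c' at *
  have hγ : γ = α * b + β * b ^ 2 := le_antisymm f2 e2
  subst hγ
  have k1 : 0 ≤ α + β * (a + b) := by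
    by_contra h; push Not at h
    nlinarith [mul_pos (sub_pos.2 hab) (neg_pos.2 h)]
  have k3 : α + β * (c + b) ≤ 0 := by
    by_contra h; push Not at h
    nlinarith [mul_pos (sub_pos.2 hbc) h]
  have k1' : α + β * (a' + b) ≤ 0 := by
    by_contra h; push Not at h
    nlinarith [mul_pos (sub_pos.2 hab') h]
  have k3' : 0 ≤ α + β * (c' + b) := by
    by_contra h; push Not at h
    nlinarith [mul_pos (sub_pos.2 hbc') (neg_pos.2 h)]
  have b1 : β ≤ 0 := by
    by_contra h; push Not at h
    nlinarith [mul_pos h (sub_pos.2 (hab.trans hbc))]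
  have b2 : 0 ≤ β := by
    by_contra h; push Not at h
    nlinarith [mul_pos (neg_pos.2 h) (sub_pos.2 (hab'.trans hbc'))]
  have hβ : β = 0 := le_antisymm b1 b2
  subst hβ
  rcases hne with h | h
  · apply h; linarith
  · exact h rfl

lemma interior_biUnion_empty (F : Finset (Set Pl)) (hc : ∀ t ∈ F, IsClosed t)
    (he : ∀ t ∈ F, interior t = ∅) : interior (⋃ t ∈ F, t) = ∅ := by
  classical
  induction F using Finset.induction_on with
  | empty => simp
  | insert t F _ ih =>
    rw [Finset.set_biUnion_insert, interior_union_isClosed_of_interior_empty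
      (hc t (by simp)) (ih (fun s hs => hc s (by simp [hs])) (fun s hs => he s (by simp [hs])))]
    exact he t (by simp)

open Classical in
lemma two_tiles {S : Finset Pl} {𝒯 : Finset (Set Pl)} (h : IsSteinerConvexPartition S 𝒯)
    {b : Pl} (hb : b ∈ S) (hbi : b ∈ interior (convexHull ℝ (S : Set Pl))) :
    ∃ t ∈ 𝒯, ∃ t' ∈ 𝒯, t ≠ t' ∧ (interior t).Nonempty ∧ (interior t').Nonempty ∧
      b ∈ t ∧ b ∈ t' := by
  obtain ⟨h1, h2, h3⟩ := h
  by_contra hcon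
  push Not at hcon
  -- a set t0 closed with b not interior, containing all thick tiles through b
  obtain ⟨t0, ht0c, ht0i, ht0⟩ : ∃ t0 : Set Pl, IsClosed t0 ∧ b ∉ interior t0 ∧
      ∀ t ∈ 𝒯, (interior t).Nonempty → b ∈ t → t = t0 := by
    by_cases hex : ∃ t ∈ 𝒯, (interior t).Nonempty ∧ b ∈ t
    · obtain ⟨t, ht, hti, hbt⟩ := hex
      refine ⟨t, (h1 t ht).2.1.isClosed, (h1 t ht).2.2 b hb, fun t' ht' hti' hbt' => ?_⟩
      by_contra hne
      exact hcon t ht t' ht' (Ne.symm hne) hti hti' hbt hbt'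
    · push Not at hex
      exact ⟨∅, isClosed_empty, by simp, fun t ht hti hbt => absurd hbt (hex t ht hti)⟩
  set D := 𝒯.filter (fun t => interior t = ∅)
  set O := 𝒯.filter (fun t => b ∉ t)
  have hO : IsClosed (⋃ t ∈ O, t) :=
    O.finite_toSet.isClosed_biUnion (fun t ht => (h1 t (Finset.mem_filter.1 ht).1).2.1.isClosed)
  have hD : interior (⋃ t ∈ D, t) = ∅ := interior_biUnion_empty D
    (fun t ht => (h1 t (Finset.mem_filter.1 ht).1).2.1.isClosed)
    (fun t ht => (Finset.mem_filter.1 ht).2)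
  have hbO : b ∉ ⋃ t ∈ O, t := by
    simp only [Set.mem_iUnion, not_exists]
    intro t ht; exact (Finset.mem_filter.1 ht).2
  set U := interior (convexHull ℝ (S : Set Pl)) ∩ (⋃ t ∈ O, t)ᶜ
  have hU : IsOpen U := isOpen_interior.inter hO.isOpen_compl
  have hbU : b ∈ U := ⟨hbi, hbO⟩
  have hsub : U ∩ t0ᶜ ⊆ ⋃ t ∈ D, t := by
    rintro x ⟨⟨hx1, hx2⟩, hx3⟩
    have hx : x ∈ ⋃ t ∈ 𝒯, t := by rw [h2]; exact interior_subset hx1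
    simp only [Set.mem_iUnion] at hx
    obtain ⟨t, ht, hxt⟩ := hx
    by_cases hbt : b ∈ t
    · by_cases hti : (interior t).Nonempty
      · exact absurd (ht0 t ht hti hbt ▸ hxt) hx3
      · exact Set.mem_biUnion (Finset.mem_filter.2 ⟨ht, Set.not_nonempty_iff_eq_empty.1 hti⟩) hxt
    · exact absurd (Set.mem_biUnion (Finset.mem_filter.2 ⟨ht, hbt⟩) hxt) hx2
  have h5 : U ∩ t0ᶜ ⊆ ∅ := by
    rw [← hD]
    exact interior_maximal hsub (hU.inter ht0c.isOpen_compl)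
  apply ht0i
  refine interior_maximal (fun x hx => ?_) hU hbU
  by_contra hxt
  exact h5 ⟨hx, hxt⟩

lemma count (m : ℕ) (hm : 2 ≤ m) (F : Finset (Set Pl))
    (hconv : ∀ t ∈ F, Convex ℝ t ∧ (interior t).Nonempty)
    (hpw : (F : Set (Set Pl)).Pairwise fun t₁ t₂ => interior t₁ ∩ interior t₂ = ∅)
    (h2 : ∀ i < m, ∃ t ∈ F, ∃ t' ∈ F, t ≠ t' ∧ bp i ∈ t ∧ bp i ∈ t') :
    m + 2 ≤ 2 * F.card := by
  classical
  let lo : Set Pl → ℕ → Prop := fun t i => bp i ∈ t ∧ ∀ j < m, bp j ∈ t → i ≤ j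
  let hi : Set Pl → ℕ → Prop := fun t i => bp i ∈ t ∧ ∀ j < m, bp j ∈ t → j ≤ i
  let L : ℕ → Finset (Set Pl) := fun i => F.filter (fun t => lo t i)
  let H : ℕ → Finset (Set Pl) := fun i => F.filter (fun t => hi t i)
  have hL : ∑ i ∈ Finset.range m, (L i).card ≤ F.card := by
    rw [← Finset.card_biUnion]
    · exact Finset.card_le_card (Finset.biUnion_subset.2 fun i _ => Finset.filter_subset _ _)
    · intro i hi' j hj hij
      rw [Function.onFun, Finset.disjoint_left]
      intro t hti htj
      have a := (Finset.mem_filter.1 hti).2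
      have b := (Finset.mem_filter.1 htj).2
      exact hij (le_antisymm (a.2 j (by simpa using hj) b.1) (b.2 i (by simpa using hi') a.1))
  have hH : ∑ i ∈ Finset.range m, (H i).card ≤ F.card := by
    rw [← Finset.card_biUnion]
    · exact Finset.card_le_card (Finset.biUnion_subset.2 fun i _ => Finset.filter_subset _ _)
    · intro i hi' j hj hij
      rw [Function.onFun, Finset.disjoint_left]
      intro t hti htj
      have a := (Finset.mem_filter.1 hti).2
      have b := (Finset.mem_filter.1 htj).2
      exact hij (le_antisymm (b.2 i (by simpa using hi') a.1) (a.2 j (by simpa using hj) b.1))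
  have key : ∀ i < m, 1 ≤ (L i).card + (H i).card := by
    intro i him
    obtain ⟨t, ht, t', ht', hne, hb, hb'⟩ := h2 i him
    by_contra hlt
    have hL0 : L i = ∅ := Finset.card_eq_zero.1 (by omega)
    have hH0 : H i = ∅ := Finset.card_eq_zero.1 (by omega)
    have hex : ∀ s ∈ F, bp i ∈ s → ∃ a c, a < i ∧ i < c ∧ bp a ∈ s ∧ bp c ∈ s := by
      intro s hs his
      have n1 : ¬ lo s i := fun h => by
        have : s ∈ L i := Finset.mem_filter.2 ⟨hs, h⟩
        rw [hL0] at this; simp at this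
      have n2 : ¬ hi s i := fun h => by
        have : s ∈ H i := Finset.mem_filter.2 ⟨hs, h⟩
        rw [hH0] at this; simp at this
      simp only [lo, hi, his, true_and] at n1 n2
      push Not at n1 n2
      obtain ⟨a, _, ha, hai⟩ := n1
      obtain ⟨c, _, hc, hci⟩ := n2
      exact ⟨a, c, hai, hci, ha, hc⟩
    obtain ⟨a, c, h3, h4, h5, h6⟩ := hex t ht hb
    obtain ⟨a', c', h3', h4', h5', h6'⟩ := hex t' ht' hb'
    exact not_both (hconv t ht).1 (hconv t' ht').1 (hconv t ht).2 (hconv t' ht').2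
      (hpw ht ht' hne) h3 h4 h3' h4' h5 hb h6 h5' hb' h6'
  have k0 : 2 ≤ (L 0).card := by
    obtain ⟨t, ht, t', ht', hne, hb, hb'⟩ := h2 0 (by omega)
    rw [← Finset.card_pair hne]
    apply Finset.card_le_card
    intro s hs
    simp only [Finset.mem_insert, Finset.mem_singleton] at hs
    rcases hs with rfl | rfl
    · exact Finset.mem_filter.2 ⟨ht, hb, fun j _ _ => Nat.zero_le _⟩
    · exact Finset.mem_filter.2 ⟨ht', hb', fun j _ _ => Nat.zero_le _⟩
  have kl : 2 ≤ (H (m - 1)).card := by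
    obtain ⟨t, ht, t', ht', hne, hb, hb'⟩ := h2 (m - 1) (by omega)
    rw [← Finset.card_pair hne]
    apply Finset.card_le_card
    intro s hs
    simp only [Finset.mem_insert, Finset.mem_singleton] at hs
    rcases hs with rfl | rfl
    · exact Finset.mem_filter.2 ⟨ht, hb, fun j _ _ => by omega⟩
    · exact Finset.mem_filter.2 ⟨ht', hb', fun j _ _ => by omega⟩
  have hsum : m + 2 ≤ ∑ i ∈ Finset.range m, ((L i).card + (H i).card) := by
    have : ∑ i ∈ Finset.range m, (1 + (if i = 0 then 1 else 0) + (if i = m - 1 then 1 else 0))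
        ≤ ∑ i ∈ Finset.range m, ((L i).card + (H i).card) := by
      apply Finset.sum_le_sum
      intro i him
      have := key i (by simpa using him)
      split_ifs with p q q
      · omega
      · subst p; omega
      · subst q; omega
      · omega
    rw [Finset.sum_add_distrib, Finset.sum_add_distrib, Finset.sum_ite_eq', Finset.sum_ite_eq',
      if_pos (by simp; omega), if_pos (by simp; omega)] at this
    simp only [Finset.sum_const, Finset.card_range, smul_eq_mul, mul_one] at this
    omega
  rw [Finset.sum_add_distrib] at hsum
  omega

lemma tri_interior (K : ℝ) (x : Pl) (h0 : -1 < x 0) (h1 : -1 < x 1) (hK : x 0 + x 1 + 1 < K) :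
    x ∈ interior (convexHull ℝ ({!₂[-1, -1], !₂[K, -1], !₂[-1, K]} : Set Pl)) := by
  have c0 : Continuous fun y : Pl => y 0 := by fun_prop
  have c1 : Continuous fun y : Pl => y 1 := by fun_prop
  have hopen : IsOpen {y : Pl | -1 < y 0 ∧ -1 < y 1 ∧ y 0 + y 1 + 1 < K} :=
    (isOpen_lt continuous_const c0).inter ((isOpen_lt continuous_const c1).inter
      (isOpen_lt ((c0.add c1).add continuous_const) continuous_const))
  refine interior_maximal ?_ hopen ⟨h0, h1, hK⟩
  rintro y ⟨h0, h1, hK⟩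
  have hK1 : 0 < K + 1 := by linarith
  set a := (y 0 + 1) / (K + 1) with ha
  set b := (y 1 + 1) / (K + 1) with hb
  have ea : a * (K + 1) = y 0 + 1 := by rw [ha]; field_simp
  have eb : b * (K + 1) = y 1 + 1 := by rw [hb]; field_simp
  have hy : y = (1 - a - b) • (!₂[-1, -1] : Pl) + a • (!₂[K, -1] : Pl) + b • (!₂[-1, K] : Pl) := by
    apply pl_ext
    · simp; linarith
    · simp; linarith
  have hab : a + b ≤ 1 := by
    have : (a + b) * (K + 1) ≤ 1 * (K + 1) := by linarith
    exact le_of_mul_le_mul_right this hK1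
  have a0 : 0 ≤ a := div_nonneg (by linarith) hK1.le
  have b0 : 0 ≤ b := div_nonneg (by linarith) hK1.le
  rw [hy]
  have hmem := (convex_convexHull ℝ ({!₂[-1, -1], !₂[K, -1], !₂[-1, K]} : Set Pl)).sum_mem
    (t := Finset.univ) (w := ![1 - a - b, a, b])
    (z := ![(!₂[-1, -1] : Pl), !₂[K, -1], !₂[-1, K]])
    (by
      intro i _
      fin_cases i
      · simp; linarith
      · simpa using a0
      · simpa using b0)
    (by simp [Fin.sum_univ_three]; ring)
    (by
      intro i _
      apply subset_convexHull
      fin_cases i <;> simp)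
  simpa [Fin.sum_univ_three] using hmem

lemma lower (n : ℕ) (hn : 6 ≤ n) : ∃ S : Finset Pl, S.card = n ∧
      ∀ 𝒯 : Finset (Set Pl),
        IsSteinerConvexPartition S 𝒯 → ⌈((n : ℚ) - 1) / 2⌉₊ ≤ 𝒯.card := by
  classical
  obtain ⟨m, rfl⟩ : ∃ m, n = m + 3 := ⟨n - 3, by omega⟩
  set K : ℝ := (m : ℝ) + (m : ℝ) ^ 2 + 2 with hK
  have hm0 : (0 : ℝ) ≤ m := Nat.cast_nonneg m
  have hKpos : 0 < K := by positivity
  let A : Finset Pl := {!₂[-1, -1], !₂[K, -1], !₂[-1, K]}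
  let B : Finset Pl := (Finset.range m).image bp
  have hA : A.card = 3 := by
    apply Finset.card_eq_three.2
    refine ⟨_, _, _, ?_, ?_, ?_, rfl⟩
    · intro h; have := congrArg (fun y : Pl => y 0) h; simp at this; linarith
    · intro h; have := congrArg (fun y : Pl => y 1) h; simp at this; linarith
    · intro h; have := congrArg (fun y : Pl => y 0) h; simp at this; linarith
  have hB : B.card = m := by
    rw [Finset.card_image_of_injective, Finset.card_range]
    intro i j h
    have := congrArg (fun y : Pl => y 0) h
    simpa [bp] using this
  have hdisj : Disjoint B A := by
    rw [Finset.disjoint_left]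
    intro x hx hxA
    obtain ⟨i, _, rfl⟩ := Finset.mem_image.1 hx
    have p0 : 0 ≤ bp i 0 := by simp [bp]
    have p1 : 0 ≤ bp i 1 := by simp [bp]
    simp only [A, Finset.mem_insert, Finset.mem_singleton] at hxA
    rcases hxA with h | h | h <;> rw [h] at p0 p1 <;> simp at p0 p1 <;> linarith
  refine ⟨B ∪ A, by rw [Finset.card_union_of_disjoint hdisj, hA, hB], fun 𝒯 h => ?_⟩
  have hbi : ∀ i < m, bp i ∈ interior (convexHull ℝ ((B ∪ A : Finset Pl) : Set Pl)) := by
    intro i him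
    have hi : (i : ℝ) < m := by exact_mod_cast him
    have hi0 : (0 : ℝ) ≤ i := Nat.cast_nonneg i
    have := tri_interior K (bp i) (by simp [bp]; linarith) (by simp [bp]; nlinarith)
      (by simp [bp, hK]; nlinarith)
    refine interior_mono (convexHull_mono ?_) this
    intro x hx
    simp only [Finset.coe_union, Set.mem_union]
    right
    simpa [A] using hx
  have hc := count m (by omega) (𝒯.filter (fun t => (interior t).Nonempty))
    (fun t ht => ⟨(h.1 t (Finset.mem_filter.1 ht).1).1, (Finset.mem_filter.1 ht).2⟩)
    (h.2.2.mono (by exact_mod_cast Finset.filter_subset _ _))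
    (fun i him => by
      obtain ⟨t, ht, t', ht', hne, h1, h2, h3, h4⟩ := two_tiles h
        (Finset.mem_union_left _ (Finset.mem_image.2 ⟨i, Finset.mem_range.2 him, rfl⟩)) (hbi i him)
      exact ⟨t, Finset.mem_filter.2 ⟨ht, h1⟩, t', Finset.mem_filter.2 ⟨ht', h2⟩, hne, h3, h4⟩)
  have hle := Finset.card_le_card (Finset.filter_subset (fun t => (interior t).Nonempty) 𝒯)
  have hfin : m + 2 ≤ 2 * 𝒯.card := by omega
  rw [Nat.ceil_le]
  have : ((m : ℚ) + 2) ≤ 2 * 𝒯.card := by exact_mod_cast hfin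
  push_cast
  linarith

end SCP

/-- For every `n ≥ 6` there is an `n`-point planar set all of whose Steiner
convex partitions have at least `⌈(n-1)/2⌉` tiles; and every `n`-point planar
set admits a Steiner convex partition with at most `⌈(n-1)/2⌉` tiles, so
`g₂(n) = ⌈(n-1)/2⌉`. -/
theorem g2_eq (n : ℕ) (hn : 6 ≤ n) :
    (∃ S : Finset (EuclideanSpace ℝ (Fin 2)), S.card = n ∧
      ∀ 𝒯 : Finset (Set (EuclideanSpace ℝ (Fin 2))),
        IsSteinerConvexPartition S 𝒯 → ⌈((n : ℚ) - 1) / 2⌉₊ ≤ 𝒯.card) ∧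
    (∀ S : Finset (EuclideanSpace ℝ (Fin 2)), S.card = n →
      ∃ 𝒯 : Finset (Set (EuclideanSpace ℝ (Fin 2))),
        IsSteinerConvexPartition S 𝒯 ∧ 𝒯.card ≤ ⌈((n : ℚ) - 1) / 2⌉₊) := by
  exact ⟨SCP.lower n hn, fun S hS => SCP.upper n hn S hS⟩
end
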